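/- arXiv:2211.12691 — 3 statements merged into one kernel-verified Lean document; each statement's English description precedes it below -/
import Mathlib

section
/- Let C_x ⊆ ℝⁿ and C_u ⊆ ℝᵐ. Let 𝓛 : ℝⁿ × ℝᵐ → ℝ be lower semicontinuous, convex (jointly in (x,u)), and strictly convex in its second argument, and suppose 𝓛 is sublevel bounded in u, i.e., for every bounded set 𝓑 ⊆ ℝⁿ and every α ∈ ℝ the set {(x,u) : x ∈ 𝓑 ∩ C_x, u ∈ D(x), 𝓛(x,u) ≤ α} is bounded. Let D : C_x ⇉ C_u be a continuous set-valued map with nonempty convex values and closed graph {(x,u) : x ∈ C_x, u ∈ D(x)}. Then for every x ∈ C_x the problem min{𝓛(x,u) : u ∈ D(x)} has a unique minimizer κ*(x), and κ* : C_x → ℝᵐ is continuous on int(C_x). -/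
open Set Filter Topology Metric Pointwise MeasureTheory
open scoped RealInnerProductSpace

noncomputable section

/-- `ℝⁿ` with the Euclidean norm. -/
abbrev Euc (n : ℕ) := EuclideanSpace ℝ (Fin n)

/-- A set-valued map `F` is upper semicontinuous on `S` if for every `x ∈ S` and `ε > 0`
there is an open neighborhood `O` of `x` with `F y ⊆ F x + ε𝔹` for all `y ∈ O ∩ S`. -/
def SVUpperSemicontinuousOn {X Y : Type*} [SeminormedAddCommGroup X] [SeminormedAddCommGroup Y]
    (S : Set X) (F : X → Set Y) : Prop :=
  ∀ x ∈ S, ∀ ε > (0:ℝ), ∃ O : Set X, IsOpen O ∧ x ∈ O ∧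
    ∀ y ∈ O ∩ S, F y ⊆ F x + Metric.closedBall 0 ε

/-- A set-valued map `F` is lower semicontinuous on `S` if for every `x ∈ S` and open `V`
meeting `F x` there is an open neighborhood `O` of `x` such that `F z` meets `V`
for every `z ∈ O ∩ S`. -/
def SVLowerSemicontinuousOn {X Y : Type*} [TopologicalSpace X] [TopologicalSpace Y]
    (S : Set X) (F : X → Set Y) : Prop :=
  ∀ x ∈ S, ∀ V : Set Y, IsOpen V → (F x ∩ V).Nonempty →
    ∃ O : Set X, IsOpen O ∧ x ∈ O ∧ ∀ z ∈ O ∩ S, (F z ∩ V).Nonempty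

/-- A set-valued map `F` is outer semicontinuous on `S`: whenever `xᵢ ∈ S → x`, `yᵢ → y`
and `yᵢ ∈ F xᵢ` for all `i`, one has `y ∈ F x`. -/
def SVOuterSemicontinuousOn {X Y : Type*} [TopologicalSpace X] [TopologicalSpace Y]
    (S : Set X) (F : X → Set Y) : Prop :=
  ∀ x ∈ S, ∀ y : Y, ∀ xs : ℕ → X, ∀ ys : ℕ → Y,
    (∀ i, xs i ∈ S) → (∀ i, ys i ∈ F (xs i)) →
    Tendsto xs atTop (𝓝 x) → Tendsto ys atTop (𝓝 y) → y ∈ F x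

/-- The Clarke generalized gradient of `B` at `x`: the convex hull of all limits of
gradients `∇B(xᵢ)` along sequences `xᵢ → x` of points of differentiability of `B`. -/
def ClarkeGradient {n : ℕ} (B : Euc n → ℝ) (x : Euc n) : Set (Euc n) :=
  convexHull ℝ {ζ | ∃ xs : ℕ → Euc n,
    (∀ i, DifferentiableAt ℝ B (xs i)) ∧
    Tendsto xs atTop (𝓝 x) ∧
    Tendsto (fun i => gradient B (xs i)) atTop (𝓝 ζ)}

/-- Lemma 4, case 1: for a lower semicontinuous, jointly convex cost `𝓛`
that is strictly convex and sublevel bounded in its second argument, and a continuous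
set-valued map `D` with nonempty convex values and closed graph, the minimizer `κ*(x)`
exists and is unique for each `x ∈ C_x` and `κ*` is continuous on `int(C_x)`. -/
theorem argmin_continuous_of_sublevel_bounded {n m : ℕ}
    (Cx : Set (Euc n)) (Cu : Set (Euc m))
    (L : Euc n × Euc m → ℝ)
    (hLlsc : LowerSemicontinuous L)
    (hLcvx : ConvexOn ℝ Set.univ L)
    (hLstrict : ∀ x : Euc n, StrictConvexOn ℝ Set.univ (fun u => L (x, u)))
    (D : Euc n → Set (Euc m))
    (hDsub : ∀ x ∈ Cx, D x ⊆ Cu)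
    (hDlsc : SVLowerSemicontinuousOn Cx D)
    (hDosc : SVOuterSemicontinuousOn Cx D)
    (hDne : ∀ x ∈ Cx, (D x).Nonempty)
    (hDcvx : ∀ x ∈ Cx, Convex ℝ (D x))
    (hDgraph : IsClosed {p : Euc n × Euc m | p.1 ∈ Cx ∧ p.2 ∈ D p.1})
    (hLbdd : ∀ B : Set (Euc n), Bornology.IsBounded B → ∀ α : ℝ,
      Bornology.IsBounded {p : Euc n × Euc m | p.1 ∈ B ∩ Cx ∧ p.2 ∈ D p.1 ∧ L p ≤ α}) :
    ∃ κ : Euc n → Euc m, ContinuousOn κ (interior Cx) ∧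
      ∀ x ∈ Cx, κ x ∈ D x ∧ (∀ u ∈ D x, L (x, κ x) ≤ L (x, u)) ∧
        (∀ u ∈ D x, (∀ u' ∈ D x, L (x, u) ≤ L (x, u')) → u = κ x) := by
  have hLcont : Continuous L := hLcvx.locallyLipschitz.continuous
  have exists_min : ∀ x, ∃ u, x ∈ Cx → u ∈ D x ∧ ∀ v ∈ D x, L (x, u) ≤ L (x, v) := by
    intro x
    by_cases hx : x ∈ Cx
    · obtain ⟨u₀, hu₀⟩ := hDne x hx
      have hclosed : IsClosed {u | u ∈ D x ∧ L (x, u) ≤ L (x, u₀)} := by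
        have hD : IsClosed {u | x ∈ Cx ∧ u ∈ D x} :=
          hDgraph.preimage (Continuous.prodMk_right x)
        simp only [hx, true_and] at hD
        exact hD.inter (isClosed_le (hLcont.comp (Continuous.prodMk_right x)) continuous_const)
      have hbdd : Bornology.IsBounded {u | u ∈ D x ∧ L (x, u) ≤ L (x, u₀)} := by
        refine (hLbdd {x} Bornology.isBounded_singleton (L (x, u₀))).image_snd.subset ?_
        rintro u ⟨hu, hle⟩
        exact ⟨(x, u), ⟨⟨rfl, hx⟩, hu, hle⟩, rfl⟩
      obtain ⟨u, hu, hmin⟩ :=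
        (Metric.isCompact_of_isClosed_isBounded hclosed hbdd).exists_isMinOn
          ⟨u₀, hu₀, le_rfl⟩ (hLcont.comp (Continuous.prodMk_right x)).continuousOn
      refine ⟨u, fun _ => ⟨hu.1, fun v hv => ?_⟩⟩
      rcases le_total (L (x, v)) (L (x, u₀)) with hle | hle
      · exact hmin ⟨hv, hle⟩
      · exact hu.2.trans hle
    · exact ⟨0, fun h => absurd h hx⟩
  choose κ hκ using exists_min
  have hunique : ∀ x ∈ Cx, ∀ u ∈ D x, (∀ v ∈ D x, L (x, u) ≤ L (x, v)) → u = κ x :=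
    fun x hx u hu hmin => ((hLstrict x).subset (subset_univ _) (hDcvx x hx)).eq_of_isMinOn
      hmin (hκ x hx).2 hu (hκ x hx).1
  refine ⟨κ, ContinuousOn.mono (fun x hx => ?_) interior_subset,
    fun x hx => ⟨(hκ x hx).1, (hκ x hx).2, hunique x hx⟩⟩
  have hvalue : ∀ c > L (x, κ x), ∀ᶠ z in 𝓝[Cx] x, L (z, κ z) < c := by
    intro c hc
    have hnhds : ∀ᶠ p in 𝓝 x ×ˢ 𝓝 (κ x), L p < c := by
      rw [← nhds_prod_eq]
      exact hLcont.continuousAt.eventually_lt continuousAt_const hc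
    obtain ⟨p, hp, q, hq, hpq⟩ := eventually_prod_iff.1 hnhds
    obtain ⟨V, hVq, hVo, hV⟩ := _root_.eventually_nhds_iff.1 hq
    obtain ⟨O, hO, hxO, hOD⟩ := hDlsc x hx V hVo ⟨κ x, (hκ x hx).1, hV⟩
    filter_upwards [self_mem_nhdsWithin, mem_nhdsWithin_of_mem_nhds (hO.mem_nhds hxO),
      mem_nhdsWithin_of_mem_nhds hp] with z hz hzO hzp
    obtain ⟨v, hv, hvV⟩ := hOD z ⟨hzO, hz⟩
    exact ((hκ z hz).2 v hv).trans_lt (hpq hzp (hVq v hvV))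
  have hbdd := (hLbdd (closedBall x 1) isBounded_closedBall (L (x, κ x) + 1)).image_snd
  refine hbdd.isCompact_closure.tendsto_nhds_of_unique_mapClusterPt ?_ ?_
  · filter_upwards [self_mem_nhdsWithin,
      mem_nhdsWithin_of_mem_nhds (closedBall_mem_nhds x one_pos),
      hvalue _ (lt_add_one _)] with z hz hzB hzL
    exact subset_closure ⟨(z, κ z), ⟨⟨hzB, hz⟩, (hκ z hz).1, hzL.le⟩, rfl⟩
  intro v _ hv
  have hmem : ∀ c > L (x, κ x), v ∈ D x ∧ L (x, v) ≤ c := by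
    intro c hc
    have hclosed : IsClosed {p : Euc n × Euc m | (p.1 ∈ Cx ∧ p.2 ∈ D p.1) ∧ L p ≤ c} :=
      hDgraph.inter (isClosed_le hLcont continuous_const)
    have hcluster : MapClusterPt (x, v) (𝓝[Cx] x) fun z => (z, κ z) := by
      rw [((𝓝 x).basis_sets.prod_nhds (𝓝 v).basis_sets).mapClusterPt_iff_frequently]
      rintro ⟨s, t⟩ ⟨hs, ht⟩
      exact ((hv.frequently ht).and_eventually (mem_nhdsWithin_of_mem_nhds hs)).mono
        fun z hz => ⟨hz.2, hz.1⟩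
    obtain ⟨⟨-, hvD⟩, hle⟩ := hclosed.mem_of_mapClusterPt hcluster <| by
      filter_upwards [self_mem_nhdsWithin, hvalue c hc] with z hz hzL
      exact ⟨⟨hz, (hκ z hz).1⟩, hzL.le⟩
    exact ⟨hvD, hle⟩
  refine hunique x hx v (hmem _ (lt_add_one _)).1 fun u hu => ?_
  exact (le_of_forall_gt_imp_ge_of_dense fun c hc => (hmem c hc).2).trans ((hκ x hx).2 u hu)
end
end

section
/- Let C_x ⊆ ℝⁿ and C_u ⊆ ℝᵐ. Let 𝓛 : ℝⁿ × ℝᵐ → ℝ be lower semicontinuous, convex (jointly in (x,u)), and strictly convex in its second argument. Let D : C_x ⇉ C_u be a continuous set-valued map with nonempty convex bounded values and closed graph {(x,u) : x ∈ C_x, u ∈ D(x)}. Then for every x ∈ C_x the problem min{𝓛(x,u) : u ∈ D(x)} has a unique minimizer κ*(x), and κ* : C_x → ℝᵐ is continuous on int(C_x). -/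
open Set Filter Topology Metric Pointwise MeasureTheory
open scoped RealInnerProductSpace

noncomputable section

/-- A segment from the open ball around `c` to its complement meets the sphere. -/
lemma exists_mem_segment_mem_sphere {E : Type*} [NormedAddCommGroup E] [NormedSpace ℝ E]
    {a b c : E} {r : ℝ} (ha : dist a c ≤ r) (hb : r ≤ dist b c) :
    ∃ w ∈ segment ℝ a b, w ∈ sphere c r :=
  (convex_segment a b).isPreconnected.intermediate_value (left_mem_segment ℝ a b)
    (right_mem_segment ℝ a b) (f := fun w => dist w c) (by fun_prop) ⟨ha, hb⟩

/-- If the values of an outer and lower semicontinuous map are convex, a selection of minimizers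
of a continuous quasiconvex cost is continuous wherever the minimizer is unique. -/
lemma continuousWithinAt_of_unique_minimizer {X E : Type*} [PseudoMetricSpace X]
    [NormedAddCommGroup E] [NormedSpace ℝ E] [ProperSpace E]
    {S : Set X} {D : X → Set E} {L : X × E → ℝ} {κ : X → E} {x : X} (hx : x ∈ S)
    (hL : Continuous L) (hLqcvx : ∀ z ∈ S, QuasiconvexOn ℝ univ (fun u => L (z, u)))
    (hDlsc : SVLowerSemicontinuousOn S D) (hDosc : SVOuterSemicontinuousOn S D)
    (hDcvx : ∀ z ∈ S, Convex ℝ (D z)) (hκ : ∀ z ∈ S, κ z ∈ D z)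
    (hmin : ∀ z ∈ S, ∀ u ∈ D z, L (z, κ z) ≤ L (z, u))
    (huniq : ∀ u ∈ D x, L (x, u) ≤ L (x, κ x) → u = κ x) :
    ContinuousWithinAt κ S x := by
  rw [Metric.continuousWithinAt_iff]
  intro ε hε
  by_contra! hfar
  have key : ∀ k : ℕ, ∃ z ∈ S, dist z x < 1 / ((k : ℝ) + 1) ∧
      ∃ u ∈ D z, dist u (κ x) < 1 / ((k : ℝ) + 1) ∧
      ∃ w ∈ D z, w ∈ sphere (κ x) ε ∧ L (z, w) ≤ L (z, u) := by
    intro k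
    have hk : (0 : ℝ) < 1 / ((k : ℝ) + 1) := Nat.one_div_pos_of_nat
    obtain ⟨O, hO, hxO, hmeet⟩ := hDlsc x hx (ball (κ x) (min ε (1 / ((k : ℝ) + 1)))) isOpen_ball
      ⟨κ x, hκ x hx, mem_ball_self (lt_min hε hk)⟩
    obtain ⟨δ, hδ, hball⟩ := Metric.isOpen_iff.1 hO x hxO
    obtain ⟨z, hzS, hzx, hκz⟩ := hfar (min δ (1 / ((k : ℝ) + 1))) (lt_min hδ hk)
    obtain ⟨u, huD, hu⟩ := hmeet z ⟨hball (hzx.trans_le (min_le_left _ _)), hzS⟩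
    rw [mem_ball, lt_min_iff] at hu
    obtain ⟨w, hw, hwε⟩ := exists_mem_segment_mem_sphere hu.1.le hκz
    have hsub := (hLqcvx z hzS (L (z, u))).segment_subset ⟨mem_univ _, le_rfl⟩
      ⟨mem_univ _, hmin z hzS u huD⟩ hw
    exact ⟨z, hzS, hzx.trans_le (min_le_right _ _), u, huD, hu.2, w,
      (hDcvx z hzS).segment_subset huD (hκ z hzS) hw, hwε, hsub.2⟩
  choose z hzS hzx u huD hu w hwD hwε hwu using key
  have hz : Tendsto z atTop (𝓝 x) := tendsto_iff_dist_tendsto_zero.2 <|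
    squeeze_zero (fun _ => dist_nonneg) (fun k => (hzx k).le) tendsto_one_div_add_atTop_nhds_zero_nat
  have hu : Tendsto u atTop (𝓝 (κ x)) := tendsto_iff_dist_tendsto_zero.2 <|
    squeeze_zero (fun _ => dist_nonneg) (fun k => (hu k).le) tendsto_one_div_add_atTop_nhds_zero_nat
  obtain ⟨v, hv, φ, hφ, hwv⟩ := (isCompact_sphere (κ x) ε).tendsto_subseq hwε
  have hzφ := hz.comp hφ.tendsto_atTop
  have hvD : v ∈ D x := hDosc x hx v (z ∘ φ) (w ∘ φ) (fun _ => hzS _) (fun _ => hwD _) hzφ hwv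
  have hle : L (x, v) ≤ L (x, κ x) := le_of_tendsto_of_tendsto'
    ((hL.tendsto _).comp (hzφ.prodMk_nhds hwv))
    ((hL.tendsto _).comp (hzφ.prodMk_nhds (hu.comp hφ.tendsto_atTop))) (fun _ => hwu _)
  rw [huniq v hvD hle, mem_sphere, dist_self] at hv
  exact hε.ne hv

/-- Lemma 4, case 2: for a lower semicontinuous, jointly convex cost `𝓛`
that is strictly convex in its second argument, and a continuous set-valued map `D` with
nonempty convex bounded values and closed graph, the minimizer `κ*(x)` exists and is
unique for each `x ∈ C_x` and `κ*` is continuous on `int(C_x)`. -/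
theorem argmin_continuous_of_bounded_values {n m : ℕ}
    (Cx : Set (Euc n)) (Cu : Set (Euc m))
    (L : Euc n × Euc m → ℝ)
    (hLlsc : LowerSemicontinuous L)
    (hLcvx : ConvexOn ℝ Set.univ L)
    (hLstrict : ∀ x : Euc n, StrictConvexOn ℝ Set.univ (fun u => L (x, u)))
    (D : Euc n → Set (Euc m))
    (hDsub : ∀ x ∈ Cx, D x ⊆ Cu)
    (hDlsc : SVLowerSemicontinuousOn Cx D)
    (hDosc : SVOuterSemicontinuousOn Cx D)
    (hDne : ∀ x ∈ Cx, (D x).Nonempty)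
    (hDcvx : ∀ x ∈ Cx, Convex ℝ (D x))
    (hDbdd : ∀ x ∈ Cx, Bornology.IsBounded (D x))
    (hDgraph : IsClosed {p : Euc n × Euc m | p.1 ∈ Cx ∧ p.2 ∈ D p.1}) :
    ∃ κ : Euc n → Euc m, ContinuousOn κ (interior Cx) ∧
      ∀ x ∈ Cx, κ x ∈ D x ∧ (∀ u ∈ D x, L (x, κ x) ≤ L (x, u)) ∧
        (∀ u ∈ D x, (∀ u' ∈ D x, L (x, u) ≤ L (x, u')) → u = κ x) := by
  have hLcont : Continuous L := continuousOn_univ.1 (hLcvx.continuousOn isOpen_univ)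
  have hex : ∀ x ∈ Cx, ∃ v ∈ D x, ∀ u ∈ D x, L (x, v) ≤ L (x, u) := by
    intro x hx
    have hclosed : IsClosed (D x) := by
      simpa [preimage, hx] using hDgraph.preimage (Continuous.prodMk_right x)
    exact (isCompact_of_isClosed_isBounded hclosed (hDbdd x hx)).exists_isMinOn (hDne x hx)
      (f := fun u => L (x, u)) (by fun_prop)
  choose! κ hκ hmin using hex
  have huniq : ∀ x ∈ Cx, ∀ u ∈ D x, (∀ u' ∈ D x, L (x, u) ≤ L (x, u')) → u = κ x :=
    fun x hx u hu h => ((hLstrict x).subset (subset_univ _) (hDcvx x hx)).eq_of_isMinOn h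
      (hmin x hx) hu (hκ x hx)
  refine ⟨κ, fun x hx => ?_, fun x hx => ⟨hκ x hx, hmin x hx, huniq x hx⟩⟩
  have hxC := interior_subset hx
  exact (continuousWithinAt_of_unique_minimizer hxC hLcont
    (fun z _ => (hLstrict z).convexOn.quasiconvexOn) hDlsc hDosc hDcvx hκ hmin
    fun u hu hle => huniq x hxC u hu fun u' hu' => hle.trans (hmin x hxC u' hu')).mono
      interior_subset
end
end

section
/- Let K ⊆ ℝⁿ be closed with ∂K ≠ ∅, let ε₁ > 0, and let ε : ∂K → ℝ be continuous with ε(x) > ε₁ for all x ∈ ∂K. For a continuous δ : ∂K → (0,∞), write U_δ(∂K) := ∪_{x ∈ ∂K} (x + δ(x)𝔹) and write U_{ε₁}(∂K) := ∪_{x ∈ ∂K} (x + ε₁𝔹). Let F₁ : K ⇉ ℝᵐ and F₂ : U_ε(∂K) ⇉ ℝᵐ be continuous set-valued maps with nonempty compact convex values. Define G on K ∪ U_ε(∂K) by G(x) := F₁(x) if x ∈ K \ U_{ε₁}(∂K); G(x) := (d(x,∂K)/ε₁)·F₁(x) + (1 − d(x,∂K)/ε₁)·F₂(x) if x ∈ K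 ∩ U_{ε₁}(∂K); and G(x) := F₂(x) if x ∈ U_ε(∂K) \ K, where d(x,∂K) is the Euclidean distance from x to ∂K and αA + βB := {αa + βb : a ∈ A, b ∈ B}. Then G is lower semicontinuous and outer semicontinuous on K ∪ U_ε(∂K) with nonempty compact convex values. -/
open Set Filter Topology Metric Pointwise MeasureTheory
open scoped RealInnerProductSpace

noncomputable section

section SetValued

variable {X Y : Type*}

lemma SVLowerSemicontinuousOn.mono [TopologicalSpace X] [TopologicalSpace Y] {S T : Set X}
    {F : X → Set Y} (h : SVLowerSemicontinuousOn S F) (hTS : T ⊆ S) :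
    SVLowerSemicontinuousOn T F := by
  intro x hx V hV hne
  obtain ⟨O, hO, hxO, hz⟩ := h x (hTS hx) V hV hne
  exact ⟨O, hO, hxO, fun z hzO => hz z ⟨hzO.1, hTS hzO.2⟩⟩

lemma SVOuterSemicontinuousOn.mono [TopologicalSpace X] [TopologicalSpace Y] {S T : Set X}
    {F : X → Set Y} (h : SVOuterSemicontinuousOn S F) (hTS : T ⊆ S) :
    SVOuterSemicontinuousOn T F :=
  fun x hx y xs ys hxs hys => h x (hTS hx) y xs ys (fun i => hTS (hxs i)) hys

lemma SVLowerSemicontinuousOn.congr [TopologicalSpace X] [TopologicalSpace Y] {S : Set X}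
    {F G : X → Set Y} (h : SVLowerSemicontinuousOn S F) (hFG : EqOn G F S) :
    SVLowerSemicontinuousOn S G := by
  intro x hx V hV hne
  rw [hFG hx] at hne
  obtain ⟨O, hO, hxO, hz⟩ := h x hx V hV hne
  refine ⟨O, hO, hxO, fun z hzO => ?_⟩
  rw [hFG hzO.2]
  exact hz z hzO

lemma SVOuterSemicontinuousOn.congr [TopologicalSpace X] [TopologicalSpace Y] {S : Set X}
    {F G : X → Set Y} (h : SVOuterSemicontinuousOn S F) (hFG : EqOn G F S) :
    SVOuterSemicontinuousOn S G := by
  intro x hx y xs ys hxs hys hxt hyt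
  rw [hFG hx]
  exact h x hx y xs ys hxs (fun i => hFG (hxs i) ▸ hys i) hxt hyt

/-- Lower semicontinuity can be checked on the two pieces of a closed cover. -/
lemma SVLowerSemicontinuousOn.of_closed_cover [TopologicalSpace X] [TopologicalSpace Y]
    {S A B : Set X} {F : X → Set Y} (hA : IsClosed A) (hB : IsClosed B) (hS : S ⊆ A ∪ B)
    (hFA : SVLowerSemicontinuousOn (S ∩ A) F) (hFB : SVLowerSemicontinuousOn (S ∩ B) F) :
    SVLowerSemicontinuousOn S F := by
  intro x hx V hV hne
  have piece : ∀ C : Set X, IsClosed C → SVLowerSemicontinuousOn (S ∩ C) F →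
      ∃ O : Set X, IsOpen O ∧ x ∈ O ∧ ∀ z ∈ O ∩ (S ∩ C), (F z ∩ V).Nonempty := by
    intro C hC hFC
    by_cases hxC : x ∈ C
    · exact hFC x ⟨hx, hxC⟩ V hV hne
    · exact ⟨Cᶜ, hC.isOpen_compl, hxC, fun z hz => absurd hz.2.2 hz.1⟩
  obtain ⟨O, hO, hxO, hOz⟩ := piece A hA hFA
  obtain ⟨P, hP, hxP, hPz⟩ := piece B hB hFB
  refine ⟨O ∩ P, hO.inter hP, ⟨hxO, hxP⟩, fun z hz => ?_⟩
  rcases hS hz.2 with hzA | hzB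
  · exact hOz z ⟨hz.1.1, hz.2, hzA⟩
  · exact hPz z ⟨hz.1.2, hz.2, hzB⟩

/-- Outer semicontinuity can be checked on the two pieces of a closed cover. -/
lemma SVOuterSemicontinuousOn.of_closed_cover [TopologicalSpace X] [TopologicalSpace Y]
    {S A B : Set X} {F : X → Set Y} (hA : IsClosed A) (hB : IsClosed B) (hS : S ⊆ A ∪ B)
    (hFA : SVOuterSemicontinuousOn (S ∩ A) F) (hFB : SVOuterSemicontinuousOn (S ∩ B) F) :
    SVOuterSemicontinuousOn S F := by
  intro x hx y xs ys hxs hys hxt hyt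
  have piece : ∀ C : Set X, IsClosed C → SVOuterSemicontinuousOn (S ∩ C) F →
      (∃ᶠ i in atTop, xs i ∈ C) → y ∈ F x := by
    intro C hC hFC hfreq
    obtain ⟨φ, hφ, hφC⟩ := extraction_of_frequently_atTop hfreq
    have hxφ := hxt.comp hφ.tendsto_atTop
    exact hFC x ⟨hx, hC.mem_of_tendsto hxφ (Eventually.of_forall hφC)⟩ y (xs ∘ φ) (ys ∘ φ)
      (fun i => ⟨hxs _, hφC i⟩) (fun i => hys _) hxφ (hyt.comp hφ.tendsto_atTop)
  have hAB : ∃ᶠ i in atTop, xs i ∈ A ∨ xs i ∈ B :=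
    (Eventually.of_forall fun i => hS (hxs i)).frequently
  rcases frequently_or_distrib.1 hAB with h | h
  · exact piece A hA hFA h
  · exact piece B hB hFB h

/-- A continuous set-valued map with compact convex values is sequentially compact along
convergent sequences of its domain. -/
lemma SVOuterSemicontinuousOn.exists_subseq_tendsto [TopologicalSpace X]
    [NormedAddCommGroup Y] [NormedSpace ℝ Y] [ProperSpace Y] {S : Set X} {F : X → Set Y}
    (ho : SVOuterSemicontinuousOn S F) (hl : SVLowerSemicontinuousOn S F)
    (hne : ∀ x ∈ S, (F x).Nonempty) (hc : ∀ x ∈ S, IsCompact (F x))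
    (hv : ∀ x ∈ S, Convex ℝ (F x)) {x : X} (hx : x ∈ S) {xs : ℕ → X} {ys : ℕ → Y}
    (hxs : ∀ i, xs i ∈ S) (hys : ∀ i, ys i ∈ F (xs i)) (hxt : Tendsto xs atTop (𝓝 x)) :
    ∃ y ∈ F x, ∃ φ : ℕ → ℕ, StrictMono φ ∧ Tendsto (ys ∘ φ) atTop (𝓝 y) := by
  obtain ⟨R, hR⟩ := (hc x hx).isBounded.subset_ball 0
  obtain ⟨O, hO, hxO, hOz⟩ := hl x hx (ball 0 R) isOpen_ball
    ((hne x hx).mono fun y hy => ⟨hy, hR hy⟩)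
  have hmeet : ∀ᶠ i in atTop, (F (xs i) ∩ ball 0 R).Nonempty :=
    (hxt.eventually (hO.mem_nhds hxO)).mono fun i hi => hOz _ ⟨hi, hxs i⟩
  have hbdd : ∃ᶠ i in atTop, ys i ∈ closedBall (0 : Y) R := by
    intro hfar
    -- values far away would, by convexity, accumulate on the sphere of radius `R`
    have hsph : ∀ᶠ i in atTop, ∃ w ∈ F (xs i), ‖w‖ = R := by
      filter_upwards [hmeet, hfar] with i ⟨z, hz, hzR⟩ hi
      rw [mem_ball_zero_iff] at hzR
      rw [mem_closedBall_zero_iff, not_le] at hi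
      exact (hv _ (hxs i)).isPreconnected.intermediate_value hz (hys i)
        continuous_norm.continuousOn ⟨hzR.le, hi.le⟩
    obtain ⟨N, hN⟩ := eventually_atTop.1 hsph
    choose w hwF hwR using fun i => hN (i + N) (Nat.le_add_left N i)
    obtain ⟨a, ha, φ, hφ, hφt⟩ := (isCompact_sphere (0 : Y) R).tendsto_subseq
      (x := w) (fun i => by simpa using hwR i)
    have haF : a ∈ F x := ho x hx a (fun i => xs (φ i + N)) (w ∘ φ) (fun i => hxs _)
      (fun i => hwF _) (((tendsto_add_atTop_iff_nat N).2 hxt).comp hφ.tendsto_atTop) hφt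
    exact (mem_ball.1 (hR haF)).ne (mem_sphere.1 ha)
  obtain ⟨y, -, φ, hφ, hφt⟩ := tendsto_subseq_of_frequently_bounded isBounded_closedBall hbdd
  exact ⟨y, ho x hx y (xs ∘ φ) (ys ∘ φ) (fun i => hxs _) (fun i => hys _)
    (hxt.comp hφ.tendsto_atTop) hφt, φ, hφ, hφt⟩

/-- A combination of lower semicontinuous set-valued maps with continuous coefficients is lower
semicontinuous. -/
lemma SVLowerSemicontinuousOn.smul_add_smul [TopologicalSpace X] [NormedAddCommGroup Y]
    [NormedSpace ℝ Y] {S : Set X} {F₁ F₂ : X → Set Y} {s t : X → ℝ}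
    (hs : Continuous s) (ht : Continuous t)
    (h₁ : SVLowerSemicontinuousOn S F₁) (h₂ : SVLowerSemicontinuousOn S F₂) :
    SVLowerSemicontinuousOn S (fun x => s x • F₁ x + t x • F₂ x) := by
  rintro x hx V hV ⟨_, ⟨_, ⟨a, ha, rfl⟩, _, ⟨b, hb, rfl⟩, rfl⟩, hyV⟩
  have hcont : Continuous fun p : X × Y × Y => s p.1 • p.2.1 + t p.1 • p.2.2 := by fun_prop
  have hnhds : {p : X × Y × Y | s p.1 • p.2.1 + t p.1 • p.2.2 ∈ V} ∈ 𝓝 (x, a, b) :=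
    (hV.preimage hcont).mem_nhds hyV
  obtain ⟨O, W, hO, hxO, hW, habW, hOW⟩ := mem_nhds_prod_iff'.1 hnhds
  obtain ⟨A, B, hA, haA, hB, hbB, hAB⟩ := mem_nhds_prod_iff'.1 (hW.mem_nhds habW)
  obtain ⟨P, hP, hxP, hPz⟩ := h₁ x hx A hA ⟨a, ha, haA⟩
  obtain ⟨Q, hQ, hxQ, hQz⟩ := h₂ x hx B hB ⟨b, hb, hbB⟩
  refine ⟨O ∩ (P ∩ Q), hO.inter (hP.inter hQ), ⟨hxO, hxP, hxQ⟩, fun z hz => ?_⟩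
  obtain ⟨a', ha', haA'⟩ := hPz z ⟨hz.1.2.1, hz.2⟩
  obtain ⟨b', hb', hbB'⟩ := hQz z ⟨hz.1.2.2, hz.2⟩
  have hmem : (z, a', b') ∈ O ×ˢ W := ⟨hz.1.1, hAB ⟨haA', hbB'⟩⟩
  exact ⟨_, add_mem_add (smul_mem_smul_set ha') (smul_mem_smul_set hb'), hOW hmem⟩

/-- A combination of continuous set-valued maps with nonempty compact convex values and
continuous coefficients is outer semicontinuous. -/
lemma SVOuterSemicontinuousOn.smul_add_smul [TopologicalSpace X] [NormedAddCommGroup Y]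
    [NormedSpace ℝ Y] [ProperSpace Y] {S : Set X} {F₁ F₂ : X → Set Y} {s t : X → ℝ}
    (hs : Continuous s) (ht : Continuous t)
    (ho₁ : SVOuterSemicontinuousOn S F₁) (hl₁ : SVLowerSemicontinuousOn S F₁)
    (hne₁ : ∀ x ∈ S, (F₁ x).Nonempty) (hc₁ : ∀ x ∈ S, IsCompact (F₁ x))
    (hv₁ : ∀ x ∈ S, Convex ℝ (F₁ x))
    (ho₂ : SVOuterSemicontinuousOn S F₂) (hl₂ : SVLowerSemicontinuousOn S F₂)
    (hne₂ : ∀ x ∈ S, (F₂ x).Nonempty) (hc₂ : ∀ x ∈ S, IsCompact (F₂ x))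
    (hv₂ : ∀ x ∈ S, Convex ℝ (F₂ x)) :
    SVOuterSemicontinuousOn S (fun x => s x • F₁ x + t x • F₂ x) := by
  intro x hx y xs ys hxs hys hxt hyt
  have hdec : ∀ i, ∃ a ∈ F₁ (xs i), ∃ b ∈ F₂ (xs i), s (xs i) • a + t (xs i) • b = ys i := by
    intro i
    obtain ⟨_, ⟨a, ha, rfl⟩, _, ⟨b, hb, rfl⟩, hab⟩ := hys i
    exact ⟨a, ha, b, hb, hab⟩
  choose a ha b hb hab using hdec
  obtain ⟨a₀, ha₀, φ, hφ, hφt⟩ := ho₁.exists_subseq_tendsto hl₁ hne₁ hc₁ hv₁ hx hxs ha hxt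
  have hxφ := hxt.comp hφ.tendsto_atTop
  obtain ⟨b₀, hb₀, ψ, hψ, hψt⟩ := ho₂.exists_subseq_tendsto hl₂ hne₂ hc₂ hv₂ hx
    (fun i => hxs (φ i)) (fun i => hb (φ i)) hxφ
  have hxψ := hxφ.comp hψ.tendsto_atTop
  have hlim := (((hs.tendsto x).comp hxψ).smul (hφt.comp hψ.tendsto_atTop)).add
    (((ht.tendsto x).comp hxψ).smul hψt)
  have hy : y = s x • a₀ + t x • b₀ := by
    refine tendsto_nhds_unique (hyt.comp (hφ.comp hψ).tendsto_atTop) (hlim.congr fun i => ?_)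
    exact hab (φ (ψ i))
  rw [hy]
  exact add_mem_add (smul_mem_smul_set ha₀) (smul_mem_smul_set hb₀)

end SetValued

/-- The closed thickening of a nonempty closed set is the union of the closed balls centered at
its points. -/
lemma mem_iUnion_closedBall_iff_infDist_le {X : Type*} [PseudoMetricSpace X] [ProperSpace X]
    {A : Set X} (hA : IsClosed A) (hne : A.Nonempty) (r : ℝ) (x : X) :
    x ∈ ⋃ p ∈ A, closedBall p r ↔ infDist x A ≤ r := by
  simp only [mem_iUnion, mem_closedBall, exists_prop]
  constructor
  · rintro ⟨p, hp, hpr⟩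
    exact (infDist_le_dist_of_mem hp).trans hpr
  · intro h
    obtain ⟨p, hp, hpe⟩ := hA.exists_infDist_eq_dist hne x
    exact ⟨p, hp, hpe ▸ h⟩

/-- Lemma 5: the piecewise Minkowski blending `G` of two continuous
set-valued maps `F₁` (on `K`) and `F₂` (on the `ε`-neighborhood of `∂K`) is lower and
outer semicontinuous on `K ∪ U_ε(∂K)` with nonempty compact convex values. -/
theorem blended_svmap_continuous {n m : ℕ}
    (K : Set (Euc n)) (hKcl : IsClosed K) (hKfr : (frontier K).Nonempty)
    (ε₁ : ℝ) (hε₁ : 0 < ε₁)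
    (ε : Euc n → ℝ) (hεcont : ContinuousOn ε (frontier K))
    (hεgt : ∀ x ∈ frontier K, ε₁ < ε x)
    (Uε Uε₁ : Set (Euc n))
    (hUε : Uε = ⋃ x ∈ frontier K, Metric.closedBall x (ε x))
    (hUε₁ : Uε₁ = ⋃ x ∈ frontier K, Metric.closedBall x ε₁)
    (F₁ : Euc n → Set (Euc m)) (F₂ : Euc n → Set (Euc m))
    (hF₁lsc : SVLowerSemicontinuousOn K F₁)
    (hF₁osc : SVOuterSemicontinuousOn K F₁)
    (hF₁ne : ∀ x ∈ K, (F₁ x).Nonempty)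
    (hF₁cpt : ∀ x ∈ K, IsCompact (F₁ x))
    (hF₁cvx : ∀ x ∈ K, Convex ℝ (F₁ x))
    (hF₂lsc : SVLowerSemicontinuousOn Uε F₂)
    (hF₂osc : SVOuterSemicontinuousOn Uε F₂)
    (hF₂ne : ∀ x ∈ Uε, (F₂ x).Nonempty)
    (hF₂cpt : ∀ x ∈ Uε, IsCompact (F₂ x))
    (hF₂cvx : ∀ x ∈ Uε, Convex ℝ (F₂ x))
    (G : Euc n → Set (Euc m))
    (hG₁ : ∀ x ∈ K \ Uε₁, G x = F₁ x)
    (hG₃ : ∀ x ∈ K ∩ Uε₁, G x =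
      (Metric.infDist x (frontier K) / ε₁) • F₁ x +
        (1 - Metric.infDist x (frontier K) / ε₁) • F₂ x)
    (hG₂ : ∀ x ∈ Uε \ K, G x = F₂ x) :
    SVLowerSemicontinuousOn (K ∪ Uε) G ∧
    SVOuterSemicontinuousOn (K ∪ Uε) G ∧
    ∀ x ∈ K ∪ Uε, (G x).Nonempty ∧ IsCompact (G x) ∧ Convex ℝ (G x) := by
  let d : Euc n → ℝ := fun x => infDist x (frontier K)
  have hdc : Continuous d := continuous_infDist_pt _
  have hmem₁ : ∀ x, x ∈ Uε₁ ↔ d x ≤ ε₁ := fun x => by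
    rw [hUε₁]
    exact mem_iUnion_closedBall_iff_infDist_le isClosed_frontier hKfr ε₁ x
  have hsub : Uε₁ ⊆ Uε := by
    rw [hUε, hUε₁]
    exact iUnion₂_mono fun x hx => Metric.closedBall_subset_closedBall (hεgt x hx).le
  have hout : EqOn G F₂ ((K ∪ Uε) ∩ (interior K)ᶜ) := by
    rintro x ⟨hx, hxi⟩
    by_cases hxK : x ∈ K
    · have hxf : x ∈ frontier K := ⟨subset_closure hxK, hxi⟩
      have hd0 : infDist x (frontier K) = 0 := infDist_zero_of_mem hxf
      have hx₁ : x ∈ Uε₁ := (hmem₁ x).2 (hd0.trans_le hε₁.le)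
      rw [hG₃ x ⟨hxK, hx₁⟩, hd0, zero_div, zero_smul_set (hF₁ne x hxK), sub_zero, one_smul,
        zero_add]
    · exact hG₂ x ⟨hx.resolve_left hxK, hxK⟩
  have hin : EqOn G F₁ (K ∩ {x | ε₁ ≤ d x}) := by
    rintro x ⟨hxK, hxd⟩
    by_cases hx₁ : x ∈ Uε₁
    · have hde : infDist x (frontier K) = ε₁ := le_antisymm ((hmem₁ x).1 hx₁) hxd
      rw [hG₃ x ⟨hxK, hx₁⟩, hde, div_self hε₁.ne', sub_self, one_smul,
        zero_smul_set (hF₂ne x (hsub hx₁)), add_zero]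
    · exact hG₁ x ⟨hxK, hx₁⟩
  have hmid : EqOn G (fun x => (d x / ε₁) • F₁ x + (1 - d x / ε₁) • F₂ x)
      (K ∩ {x | d x ≤ ε₁}) := fun x hx => hG₃ x ⟨hx.1, (hmem₁ x).2 hx.2⟩
  have houtsub : (K ∪ Uε) ∩ (interior K)ᶜ ⊆ Uε := by
    rintro x ⟨hxK | hxU, hxi⟩
    · refine hsub ((hmem₁ x).2 ?_)
      exact (infDist_zero_of_mem (show x ∈ frontier K from ⟨subset_closure hxK, hxi⟩)).trans_le hε₁.le
    · exact hxU
  have hmidsub : K ∩ {x | d x ≤ ε₁} ⊆ Uε := fun x hx => hsub ((hmem₁ x).2 hx.2)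
  have hs : Continuous fun x => d x / ε₁ := hdc.div_const _
  have ht : Continuous fun x => 1 - d x / ε₁ := continuous_const.sub hs
  have hcl₁ : IsClosed {x | d x ≤ ε₁} := isClosed_le hdc continuous_const
  have hcl₂ : IsClosed {x | ε₁ ≤ d x} := isClosed_le continuous_const hdc
  have hcov : K ⊆ {x | d x ≤ ε₁} ∪ {x | ε₁ ≤ d x} := fun x _ => le_total (d x) ε₁
  have hcli : IsClosed (interior K)ᶜ := isOpen_interior.isClosed_compl
  have hcovK : K ∪ Uε ⊆ K ∪ (interior K)ᶜ := fun x _ => by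
    by_cases hx : x ∈ K
    · exact Or.inl hx
    · exact Or.inr fun h => hx (interior_subset h)
  have hKeq : (K ∪ Uε) ∩ K = K := union_inter_cancel_left
  refine ⟨.of_closed_cover hKcl hcli hcovK ?_ ((hF₂lsc.mono houtsub).congr hout),
    .of_closed_cover hKcl hcli hcovK ?_ ((hF₂osc.mono houtsub).congr hout), ?_⟩
  · rw [hKeq]
    exact .of_closed_cover hcl₁ hcl₂ hcov
      ((SVLowerSemicontinuousOn.smul_add_smul hs ht (hF₁lsc.mono inter_subset_left)
        (hF₂lsc.mono hmidsub)).congr hmid)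
      ((hF₁lsc.mono inter_subset_left).congr hin)
  · rw [hKeq]
    exact .of_closed_cover hcl₁ hcl₂ hcov
      ((SVOuterSemicontinuousOn.smul_add_smul hs ht
        (hF₁osc.mono inter_subset_left) (hF₁lsc.mono inter_subset_left)
        (fun x hx => hF₁ne x hx.1) (fun x hx => hF₁cpt x hx.1) (fun x hx => hF₁cvx x hx.1)
        (hF₂osc.mono hmidsub) (hF₂lsc.mono hmidsub)
        (fun x hx => hF₂ne x (hmidsub hx)) (fun x hx => hF₂cpt x (hmidsub hx))
        (fun x hx => hF₂cvx x (hmidsub hx))).congr hmid)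
      ((hF₁osc.mono inter_subset_left).congr hin)
  · intro x hx
    by_cases hxK : x ∈ K
    · by_cases hx₁ : x ∈ Uε₁
      · have hxU := hsub hx₁
        rw [hG₃ x ⟨hxK, hx₁⟩]
        exact ⟨(hF₁ne x hxK).smul_set.add (hF₂ne x hxU).smul_set,
          ((hF₁cpt x hxK).smul _).add ((hF₂cpt x hxU).smul _),
          ((hF₁cvx x hxK).smul _).add ((hF₂cvx x hxU).smul _)⟩
      · rw [hG₁ x ⟨hxK, hx₁⟩]
        exact ⟨hF₁ne x hxK, hF₁cpt x hxK, hF₁cvx x hxK⟩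
    · have hxU := hx.resolve_left hxK
      rw [hG₂ x ⟨hxU, hxK⟩]
      exact ⟨hF₂ne x hxU, hF₂cpt x hxU, hF₂cvx x hxU⟩
end
end
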